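/- arXiv:1612.03393 — 2 statements merged into one kernel-verified Lean document; each statement's English description precedes it below -/
import Mathlib

section
/- Let a > 0, let 𝒜 : ℝ^{m×n} → ℝ^d (m ≤ n) be a linear map and b ∈ ℝ^d. Let X₀ be a matrix with 𝒜(X₀) = b, and let X* be a global minimizer of P_a(X) subject to 𝒜(X) = b, so that in particular P_a(X*) ≤ P_a(X₀). Set R = X* − X₀. Then there exist matrices R₀ and R_c such that R = R₀ + R_c, rank(R₀) ≤ 2·rank(X₀), X₀·R_cᵀ = 0, X₀ᵀ·R_c = 0, and P_a(R_c) ≤ P_a(R₀). -/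
open Matrix Filter

/-- The singular values of a real `m × n` matrix: square roots of the eigenvalues of `X * Xᵀ`. -/
noncomputable def sv {m n : ℕ} (X : Matrix (Fin m) (Fin n) ℝ) : Fin m → ℝ :=
  fun i => Real.sqrt ((Matrix.isHermitian_mul_conjTranspose_self X).eigenvalues i)

/-- The singular values arranged in descending order: `svSorted X 0 ≥ svSorted X 1 ≥ ⋯`. -/
noncomputable def svSorted {m n : ℕ} (X : Matrix (Fin m) (Fin n) ℝ) : Fin m → ℝ :=
  fun i => sv X (Tuple.sort (sv X) i.rev)

/-- `P_a(X) = Σᵢ a σᵢ(X)/(a σᵢ(X) + 1)`. -/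
noncomputable def Pa {m n : ℕ} (a : ℝ) (X : Matrix (Fin m) (Fin n) ℝ) : ℝ :=
  ∑ i, a * sv X i / (a * sv X i + 1)

/-- Frobenius norm. -/
noncomputable def frobNorm {m n : ℕ} (X : Matrix (Fin m) (Fin n) ℝ) : ℝ :=
  Real.sqrt (∑ i, ∑ j, (X i j) ^ 2)

/-- Nuclear norm: the sum of the singular values. -/
noncomputable def nuclearNorm {m n : ℕ} (X : Matrix (Fin m) (Fin n) ℝ) : ℝ :=
  ∑ i, sv X i

/-- The rectangular `m × n` "diagonal" matrix with diagonal entries `σ`. -/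
def diagRect {m n : ℕ} (σ : Fin m → ℝ) : Matrix (Fin m) (Fin n) ℝ :=
  Matrix.of fun i j => if (j : ℕ) = (i : ℕ) then σ i else 0

/-- The `r`-restricted isometry constant `δ_r(𝒜)`. -/
noncomputable def ripConst {m n d : ℕ}
    (A : Matrix (Fin m) (Fin n) ℝ →ₗ[ℝ] EuclideanSpace ℝ (Fin d)) (r : ℕ) : ℝ :=
  sInf {δ : ℝ | 0 ≤ δ ∧ ∀ X : Matrix (Fin m) (Fin n) ℝ, X.rank ≤ r →
    (1 - δ) * frobNorm X ^ 2 ≤ ‖A X‖ ^ 2 ∧ ‖A X‖ ^ 2 ≤ (1 + δ) * frobNorm X ^ 2}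

open Polynomial in
lemma Matrix.charpoly_mul_charpoly_of_mul_eq_zero {ι R : Type*} [Fintype ι] [DecidableEq ι]
    [CommRing R] (A B : Matrix ι ι R) (h : A * B = 0) :
    A.charpoly * B.charpoly = X ^ Fintype.card ι * (A + B).charpoly := by
  rw [Matrix.charpoly, Matrix.charpoly, Matrix.charpoly, ← Matrix.det_mul, ← Matrix.det_smul]
  congr 1
  have hAB : A.map (C : R →+* R[X]) * B.map (C : R →+* R[X]) = 0 := by
    rw [← Matrix.map_mul, h]; simp
  have hs : ∀ M : Matrix ι ι R[X], Matrix.scalar ι (X : R[X]) * M = (X : R[X]) • M := by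
    intro M; ext i j; simp [Matrix.scalar]
  have hs' : ∀ M : Matrix ι ι R[X], M * Matrix.scalar ι (X : R[X]) = (X : R[X]) • M := by
    intro M; ext i j; simp [Matrix.scalar, mul_comm]
  have hm : (A + B).map (C : R →+* R[X]) = A.map (C : R →+* R[X]) + B.map (C : R →+* R[X]) := by
    ext i j; simp
  simp only [Matrix.charmatrix, RingHom.mapMatrix_apply, hm]
  rw [sub_mul, mul_sub, mul_sub, hAB, hs, hs, hs', sub_zero, ← smul_sub, ← smul_sub, sub_right_comm,
    sub_sub]

lemma Matrix.IsHermitian.sum_eigenvalues_add_of_mul_eq_zero {ι : Type*} [Fintype ι]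
    [DecidableEq ι] {A B D : Matrix ι ι ℝ} (hA : A.IsHermitian) (hB : B.IsHermitian)
    (hD : D.IsHermitian) (h : A * B = 0) (hADB : D = A + B) (g : ℝ → ℝ) (hg : g 0 = 0) :
    ∑ i, g (hD.eigenvalues i) = ∑ i, g (hA.eigenvalues i) + ∑ i, g (hB.eigenvalues i) := by
  have key := congrArg Polynomial.roots (Matrix.charpoly_mul_charpoly_of_mul_eq_zero A B h)
  rw [← hADB, Polynomial.roots_mul (mul_ne_zero A.charpoly_monic.ne_zero B.charpoly_monic.ne_zero),
    Polynomial.roots_mul (mul_ne_zero (pow_ne_zero _ Polynomial.X_ne_zero)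
      D.charpoly_monic.ne_zero),
    hA.roots_charpoly_eq_eigenvalues, hB.roots_charpoly_eq_eigenvalues,
    hD.roots_charpoly_eq_eigenvalues] at key
  have key' := congrArg (fun s => (s.map g).sum) key
  simp only [Polynomial.roots_X_pow, Multiset.map_add, Multiset.map_nsmul, Multiset.map_singleton,
    RCLike.ofReal_real_eq_id, hg, Multiset.sum_add, Multiset.sum_nsmul,
    Multiset.sum_singleton, smul_zero, zero_add, Multiset.map_map] at key'
  exact key'.symm

lemma sv_nonneg {m n : ℕ} (X : Matrix (Fin m) (Fin n) ℝ) (i : Fin m) : 0 ≤ sv X i :=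
  Real.sqrt_nonneg _

lemma sv_neg {m n : ℕ} (X : Matrix (Fin m) (Fin n) ℝ) : sv (-X) = sv X := by
  have h : (-X) * (-X)ᴴ = X * Xᴴ := by simp
  have key : ∀ {M N : Matrix (Fin m) (Fin m) ℝ} (hM : M.IsHermitian) (hN : N.IsHermitian),
      M = N → hM.eigenvalues = hN.eigenvalues := by
    rintro M _ hM hN rfl; rfl
  funext i
  rw [sv, sv, key _ (isHermitian_mul_conjTranspose_self X) h]

lemma Pa_neg {m n : ℕ} (a : ℝ) (X : Matrix (Fin m) (Fin n) ℝ) : Pa a (-X) = Pa a X := by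
  simp only [Pa, sv_neg]

lemma Pa_add_of_orthogonal {m n : ℕ} (a : ℝ) (X Y : Matrix (Fin m) (Fin n) ℝ)
    (h₁ : X * Yᵀ = 0) (h₂ : Xᵀ * Y = 0) : Pa a (X + Y) = Pa a X + Pa a Y := by
  have h₃ : Y * Xᵀ = 0 := by simpa using congrArg Matrix.transpose h₁
  refine Matrix.IsHermitian.sum_eigenvalues_add_of_mul_eq_zero
    (Matrix.isHermitian_mul_conjTranspose_self X) (Matrix.isHermitian_mul_conjTranspose_self Y)
    (Matrix.isHermitian_mul_conjTranspose_self (X + Y)) ?_ ?_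
    (fun t => a * √t / (a * √t + 1)) (by simp)
  · simp only [Matrix.conjTranspose_eq_transpose_of_trivial]
    rw [Matrix.mul_assoc, ← Matrix.mul_assoc Xᵀ, h₂]; simp
  · simp only [Matrix.conjTranspose_eq_transpose_of_trivial]
    rw [Matrix.transpose_add, Matrix.add_mul, Matrix.mul_add, Matrix.mul_add, h₁, h₃]; simp

/-- A thin singular value decomposition with respect to `sv`: the columns of `V` with vanishing
singular value are zero. -/
lemma exists_svd {m n : ℕ} (X : Matrix (Fin m) (Fin n) ℝ) :
    ∃ (U : Matrix (Fin m) (Fin m) ℝ) (V : Matrix (Fin n) (Fin m) ℝ),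
      U * Uᵀ = 1 ∧ Uᵀ * U = 1 ∧ X = U * diagonal (sv X) * Vᵀ ∧
      Vᵀ * V = diagonal (fun i => if sv X i = 0 then 0 else 1) := by
  set hH := Matrix.isHermitian_mul_conjTranspose_self X
  obtain ⟨U, hU⟩ : ∃ U : Matrix (Fin m) (Fin m) ℝ, U = hH.eigenvectorUnitary := ⟨_, rfl⟩
  have hU1 : U * Uᵀ = 1 := by
    have := Unitary.coe_mul_star_self hH.eigenvectorUnitary
    rwa [Unitary.coe_star, ← hU, Matrix.star_eq_conjTranspose, conjTranspose_eq_transpose_of_trivial] at this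
  have hU2 : Uᵀ * U = 1 := by
    have := Unitary.coe_star_mul_self hH.eigenvectorUnitary
    rwa [← hU, Matrix.star_eq_conjTranspose, conjTranspose_eq_transpose_of_trivial] at this
  have hsv : ∀ i, hH.eigenvalues i = sv X i * sv X i := fun i =>
    (Real.mul_self_sqrt ((posSemidef_self_mul_conjTranspose X).eigenvalues_nonneg i)).symm
  have hspec : (Uᵀ * X) * (Uᵀ * X)ᵀ = diagonal (fun i => sv X i * sv X i) := by
    have h := hH.conjStarAlgAut_star_eigenvectorUnitary
    rw [Unitary.conjStarAlgAut_apply] at h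
    rw [Unitary.coe_star, star_star, ← hU, Matrix.star_eq_conjTranspose] at h
    simp only [conjTranspose_eq_transpose_of_trivial] at h
    rw [Matrix.transpose_mul, Matrix.transpose_transpose]
    simp only [Matrix.mul_assoc] at h ⊢
    rw [h]
    congr 1
    funext i
    exact hsv i
  set Y := Uᵀ * X with hY
  refine ⟨U, Yᵀ * diagonal (fun i => (sv X i)⁻¹), hU1, hU2, ?_, ?_⟩
  · have hYrow : diagonal (sv X) * (diagonal (fun i => (sv X i)⁻¹) * Y) = Y := by
      ext i j
      simp only [diagonal_mul]
      by_cases h0 : sv X i = 0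
      · have h1 := congrFun (congrFun hspec i) i
        simp only [Matrix.mul_apply, Matrix.transpose_apply, diagonal_apply_eq, h0, mul_zero] at h1
        have h2 := (Finset.sum_eq_zero_iff_of_nonneg
          (fun k _ => mul_self_nonneg (Y i k))).1 h1 j (Finset.mem_univ _)
        simp [h0, mul_self_eq_zero.1 h2]
      · field_simp
    rw [Matrix.transpose_mul, Matrix.transpose_transpose, diagonal_transpose, Matrix.mul_assoc,
      hYrow, hY, ← Matrix.mul_assoc, hU1, Matrix.one_mul]
  · rw [Matrix.transpose_mul, Matrix.transpose_transpose, diagonal_transpose, Matrix.mul_assoc,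
      ← Matrix.mul_assoc Y, hspec, diagonal_mul_diagonal, diagonal_mul_diagonal]
    congr 1
    funext i
    split_ifs with h <;> [simp [h]; field_simp]

lemma rank_diagonal_sv {m n : ℕ} (X : Matrix (Fin m) (Fin n) ℝ) :
    (diagonal (fun i => if sv X i = 0 then (0 : ℝ) else 1)).rank = X.rank := by
  rw [rank_diagonal, ← rank_self_mul_conjTranspose X,
    (isHermitian_mul_conjTranspose_self X).rank_eq_card_non_zero_eigs]
  refine Fintype.card_congr (Equiv.subtypeEquivRight fun i => ?_)
  have := (posSemidef_self_mul_conjTranspose X).eigenvalues_nonneg i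
  have h : sv X i = 0 ↔ (isHermitian_mul_conjTranspose_self X).eigenvalues i = 0 :=
    Real.sqrt_eq_zero this
  simp [h]

lemma transpose_mul_apply {l p q : Type*} [Fintype p] (M : Matrix p l ℝ) (N : Matrix p q ℝ)
    (i : l) (j : q) : (Mᵀ * N) i j = ∑ k, M k i * N k j := rfl

lemma sq_diag_le_mul_self_diag {ι : Type*} [Fintype ι] (G : Matrix ι ι ℝ) (hG : Gᵀ = G) (i : ι) :
    G i i ^ 2 ≤ (G * G) i i := by
  rw [Matrix.mul_apply, sq]
  have h : ∀ k, G k i = G i k := fun k => congrFun (congrFun hG i) k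
  simp only [h]
  exact Finset.single_le_sum (f := fun k => G i k * G i k) (fun k _ => mul_self_nonneg _)
    (Finset.mem_univ i)

/-- With `K = (1 + P Pᵀ + Q Qᵀ)⁻¹`, the diagonal of `Pᵀ K P` is dominated by `t / (t + 1)` at the
diagonal of `Pᵀ P`. -/
lemma diag_transpose_mul_inv_mul_le {ι : Type*} [Fintype ι] [DecidableEq ι] (P Q K : Matrix ι ι ℝ)
    (hK : Kᵀ = K) (hKinv : K * (1 + (P * Pᵀ + Q * Qᵀ)) = 1) (d : ι → ℝ) (hd : ∀ i, 0 ≤ d i)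
    (hP : ∀ i, (Pᵀ * P) i i ≤ d i) (i : ι) :
    (Pᵀ * K * P) i i ≤ d i / (d i + 1) := by
  have hG : (Pᵀ * K * P)ᵀ = Pᵀ * K * P := by
    simp [Matrix.transpose_mul, hK, Matrix.mul_assoc]
  have hGsq := sq_diag_le_mul_self_diag (Pᵀ * K * P) hG i
  have hid : Pᵀ * K * P = (K * P)ᵀ * (K * P) + (Pᵀ * K * P) * (Pᵀ * K * P)
      + (Qᵀ * K * P)ᵀ * (Qᵀ * K * P) := by
    have h : Pᵀ * (K * (1 + (P * Pᵀ + Q * Qᵀ))) * (K * P) = Pᵀ * K * P := by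
      rw [hKinv]; simp [Matrix.mul_assoc]
    conv_lhs => rw [← h]
    simp only [Matrix.transpose_mul, hK, Matrix.transpose_transpose]
    noncomm_ring
  have hQ : 0 ≤ ((Qᵀ * K * P)ᵀ * (Qᵀ * K * P)) i i := by
    rw [Matrix.mul_apply]
    exact Finset.sum_nonneg fun k _ => mul_self_nonneg _
  have hCS : (Pᵀ * K * P) i i ^ 2 ≤ (Pᵀ * P) i i * ((K * P)ᵀ * (K * P)) i i := by
    rw [Matrix.mul_assoc]
    simp only [transpose_mul_apply, ← sq]
    exact Finset.sum_mul_sq_le_sq_mul_sq _ _ _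
  have hJ : 0 ≤ ((K * P)ᵀ * (K * P)) i i := by
    rw [Matrix.mul_apply]
    exact Finset.sum_nonneg fun k _ => mul_self_nonneg _
  have hid' := congrFun (congrFun hid i) i
  simp only [Matrix.add_apply] at hid'
  set g := (Pᵀ * K * P) i i
  have hdi := hd i
  rw [le_div_iff₀ (by linarith)]
  have h1 : g ^ 2 ≤ d i * (g - g ^ 2) := by
    calc g ^ 2 ≤ _ := hCS
      _ ≤ d i * ((K * P)ᵀ * (K * P)) i i := mul_le_mul_of_nonneg_right (hP i) hJ
      _ ≤ d i * (g - g ^ 2) := mul_le_mul_of_nonneg_left (by linarith) hdi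
  by_contra! hlt
  have hg : 0 < g := by nlinarith
  nlinarith

lemma sum_div_add_one_le_of_posSemidef {ι : Type*} [Fintype ι] [DecidableEq ι]
    (P Q : Matrix ι ι ℝ) (s d e : ι → ℝ) (hs : ∀ i, 0 ≤ s i) (hd : ∀ i, 0 ≤ d i)
    (he : ∀ i, 0 ≤ e i) (hP : ∀ i, (Pᵀ * P) i i ≤ d i) (hQ : ∀ i, (Qᵀ * Q) i i ≤ e i)
    (hPQ : (P * Pᵀ + Q * Qᵀ - diagonal s).PosSemidef) :
    ∑ i, s i / (s i + 1) ≤ ∑ i, d i / (d i + 1) + ∑ i, e i / (e i + 1) := by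
  have hC : (P * Pᵀ + Q * Qᵀ).PosSemidef := by
    simpa using (posSemidef_self_mul_conjTranspose P).add (posSemidef_self_mul_conjTranspose Q)
  have hpd : (1 + (P * Pᵀ + Q * Qᵀ)).PosDef := Matrix.PosDef.one.add_posSemidef hC
  obtain ⟨K, hKdef⟩ : ∃ K, K = (1 + (P * Pᵀ + Q * Qᵀ))⁻¹ := ⟨_, rfl⟩
  have hK : Kᵀ = K := by
    have := hpd.inv.isHermitian.eq
    rwa [← hKdef, conjTranspose_eq_transpose_of_trivial] at this
  have hKinv : K * (1 + (P * Pᵀ + Q * Qᵀ)) = 1 := by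
    rw [hKdef]; exact Matrix.nonsing_inv_mul _ ((Matrix.isUnit_iff_isUnit_det _).1 hpd.isUnit)
  have hPb := diag_transpose_mul_inv_mul_le P Q K hK hKinv d hd hP
  have hQb := diag_transpose_mul_inv_mul_le Q P K hK
    (by rw [add_comm (Q * Qᵀ)]; exact hKinv) e he hQ
  have htr : (K * (P * Pᵀ + Q * Qᵀ) * K).trace + ((1 - K) * (1 - K)).trace
      = (Pᵀ * K * P).trace + (Qᵀ * K * Q).trace := by
    have h1 : K * (P * Pᵀ + Q * Qᵀ) = 1 - K := by
      rw [Matrix.mul_add, Matrix.mul_one] at hKinv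
      exact eq_sub_of_add_eq' hKinv
    have h2 : (Pᵀ * K * P).trace + (Qᵀ * K * Q).trace = (1 - K).trace := by
      rw [← h1, Matrix.mul_add, Matrix.trace_add, Matrix.mul_assoc, Matrix.trace_mul_comm,
        Matrix.mul_assoc Qᵀ, Matrix.trace_mul_comm Qᵀ, Matrix.mul_assoc, Matrix.mul_assoc]
    rw [h1, h2, ← Matrix.trace_add]
    congr 1
    noncomm_ring
  have hle : (K * diagonal s * K).trace ≤ (K * (P * Pᵀ + Q * Qᵀ) * K).trace := by
    have h := (hPQ.mul_mul_conjTranspose_same K).trace_nonneg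
    rw [conjTranspose_eq_transpose_of_trivial, hK, Matrix.mul_sub, Matrix.sub_mul,
      Matrix.trace_sub] at h
    linarith
  have hdiag : ∑ i, s i / (s i + 1) ≤ (K * diagonal s * K).trace + ((1 - K) * (1 - K)).trace := by
    have h1 : (K * diagonal s * K).trace = ∑ i, s i * (K * K) i i := by
      rw [Matrix.mul_assoc, Matrix.trace_mul_comm, Matrix.mul_assoc, Matrix.trace]
      simp [diagonal_mul]
    rw [h1, Matrix.trace, ← Finset.sum_add_distrib]
    refine Finset.sum_le_sum fun i _ => ?_
    have hk1 := sq_diag_le_mul_self_diag K hK i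
    have hk2 := sq_diag_le_mul_self_diag (1 - K) (by simp [hK]) i
    simp only [Matrix.sub_apply, Matrix.one_apply_eq] at hk2
    have hsi := hs i
    calc s i / (s i + 1) ≤ s i * K i i ^ 2 + (1 - K i i) ^ 2 := by
          rw [div_le_iff₀ (by linarith)]
          nlinarith [sq_nonneg ((s i + 1) * K i i - 1)]
      _ ≤ _ := add_le_add (mul_le_mul_of_nonneg_left hk1 hsi) hk2
  calc _ ≤ _ := hdiag
    _ ≤ (Pᵀ * K * P).trace + (Qᵀ * K * Q).trace := by linarith
    _ ≤ _ := add_le_add (Finset.sum_le_sum fun i _ => hPb i) (Finset.sum_le_sum fun i _ => hQb i)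

lemma diag_transpose_mul_self_le {l p q : Type*} [Fintype l] [Fintype p] [Fintype q]
    [DecidableEq q] (V : Matrix p l ℝ) (W : Matrix p q ℝ) (hV : V * Vᵀ * V = V) (i : q) :
    ((Vᵀ * W)ᵀ * (Vᵀ * W)) i i ≤ (Wᵀ * W) i i := by
  have h : Wᵀ * W - (Vᵀ * W)ᵀ * (Vᵀ * W) = (W - V * (Vᵀ * W))ᵀ * (W - V * (Vᵀ * W)) := by
    have h1 : V * (Vᵀ * (V * (Vᵀ * W))) = V * (Vᵀ * W) := by
      rw [← Matrix.mul_assoc V, ← Matrix.mul_assoc (V * Vᵀ), hV]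
    simp only [Matrix.transpose_sub, Matrix.transpose_mul, Matrix.transpose_transpose,
      Matrix.sub_mul, Matrix.mul_sub, Matrix.mul_assoc, h1]
    abel
  have h2 := congrFun (congrFun h i) i
  have h3 : 0 ≤ ((W - V * (Vᵀ * W))ᵀ * (W - V * (Vᵀ * W))) i i := by
    rw [Matrix.mul_apply]
    exact Finset.sum_nonneg fun k _ => mul_self_nonneg _
  rw [← h2, Matrix.sub_apply] at h3
  linarith

lemma half_sum_diag_le {k : Type*} [Fintype k] [DecidableEq k] (A B : Matrix k k ℝ) (d : k → ℝ)
    (hd : ∀ i, 0 ≤ d i) (hA : ∀ i, (Aᵀ * A) i i ≤ 1) (hB : ∀ i, (Bᵀ * B) i i ≤ 1) (i : k) :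
    ((((1 / 2 : ℝ) • ((A + B) * diagonal (fun i => √(d i)))))ᵀ *
      (((1 / 2 : ℝ) • ((A + B) * diagonal (fun i => √(d i)))))) i i ≤ d i := by
  have hA := hA i
  have hB := hB i
  simp only [transpose_mul_apply] at hA hB
  simp only [transpose_mul_apply, Matrix.smul_apply,
    Matrix.mul_diagonal, Matrix.add_apply, smul_eq_mul]
  have h1 : ∀ x, 1 / 2 * ((A x i + B x i) * √(d i)) * (1 / 2 * ((A x i + B x i) * √(d i)))
      ≤ d i * (1 / 2 * (A x i * A x i + B x i * B x i)) := by
    intro x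
    have h2 := Real.mul_self_sqrt (hd i)
    calc _ = (√(d i) * √(d i)) * (1 / 4 * (A x i + B x i) ^ 2) := by ring
      _ ≤ _ := by
        rw [h2]
        exact mul_le_mul_of_nonneg_left (by nlinarith [sq_nonneg (A x i - B x i)]) (hd i)
  refine (Finset.sum_le_sum fun x _ => h1 x).trans ?_
  rw [← Finset.mul_sum, ← Finset.mul_sum, Finset.sum_add_distrib]
  nlinarith [hd i]

lemma half_sum_mul_transpose_eq {k : Type*} [Fintype k] [DecidableEq k] (A B : Matrix k k ℝ)
    (d : k → ℝ) (hd : ∀ i, 0 ≤ d i) :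
    ((1 / 2 : ℝ) • ((A + B) * diagonal (fun i => √(d i)))) *
      ((1 / 2 : ℝ) • ((A + B) * diagonal (fun i => √(d i))))ᵀ
    = (1 / 2 : ℝ) • (A * diagonal d * Bᵀ + (A * diagonal d * Bᵀ)ᵀ) +
      ((1 / 2 : ℝ) • ((A - B) * diagonal (fun i => √(d i)))) *
      ((1 / 2 : ℝ) • ((A - B) * diagonal (fun i => √(d i))))ᵀ := by
  have hD : diagonal (fun i => √(d i)) * diagonal (fun i => √(d i)) = diagonal d := by
    rw [diagonal_mul_diagonal]
    congr 1
    funext i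
    exact Real.mul_self_sqrt (hd i)
  have h : ∀ E : Matrix k k ℝ, ((1 / 2 : ℝ) • (E * diagonal (fun i => √(d i)))) *
      ((1 / 2 : ℝ) • (E * diagonal (fun i => √(d i))))ᵀ
      = (1 / 4 : ℝ) • (E * diagonal d * Eᵀ) := by
    intro E
    rw [← hD]
    simp only [Matrix.transpose_smul, Matrix.transpose_mul, diagonal_transpose, Matrix.mul_assoc,
      Matrix.smul_mul, Matrix.mul_smul, smul_smul]
    norm_num
  rw [h, h]
  simp only [Matrix.transpose_add, Matrix.transpose_sub, Matrix.transpose_mul, diagonal_transpose,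
    Matrix.transpose_transpose, Matrix.add_mul, Matrix.mul_add, Matrix.sub_mul, Matrix.mul_sub,
    Matrix.mul_assoc]
  module

/-- Subadditivity of `P_a` (an instance of the Rotfeld inequality). -/
lemma Pa_add_le {m n : ℕ} (a : ℝ) (ha : 0 < a) (X Y : Matrix (Fin m) (Fin n) ℝ) :
    Pa a (X + Y) ≤ Pa a X + Pa a Y := by
  obtain ⟨U, V, hU1, hU2, hS, hV⟩ := exists_svd (X + Y)
  obtain ⟨U₁, V₁, -, hU₁, hX, hV₁⟩ := exists_svd X
  obtain ⟨U₂, V₂, -, hU₂, hY, hV₂⟩ := exists_svd Y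
  have hσV : ∀ i, sv (X + Y) i * (if sv (X + Y) i = 0 then 0 else 1) = sv (X + Y) i := by
    intro i; split_ifs with h <;> simp [h]
  have hVV : V * Vᵀ * V = V := by
    have h0 : (V * Vᵀ * V - V)ᵀ * (V * Vᵀ * V - V) = 0 := by
      have : (V * Vᵀ * V - V)ᵀ * (V * Vᵀ * V - V)
          = (Vᵀ * V) * (Vᵀ * V) * (Vᵀ * V) - (Vᵀ * V) * (Vᵀ * V) - (Vᵀ * V) * (Vᵀ * V)
            + Vᵀ * V := by
        simp only [Matrix.transpose_sub, Matrix.transpose_mul, Matrix.transpose_transpose,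
          Matrix.sub_mul, Matrix.mul_sub, Matrix.mul_assoc]
        abel
      rw [this, hV]
      simp only [diagonal_mul_diagonal, diagonal_sub, diagonal_add]
      rw [diagonal_eq_zero]
      funext i
      by_cases h : sv (X + Y) i = 0 <;> simp [h]
    rw [← conjTranspose_eq_transpose_of_trivial, conjTranspose_mul_self_eq_zero] at h0
    exact sub_eq_zero.1 h0
  have hSd : diagonal (sv (X + Y)) = Uᵀ * (X + Y) * V := by
    conv_rhs => rw [hS]
    rw [← Matrix.mul_assoc, ← Matrix.mul_assoc, hU2, Matrix.one_mul, Matrix.mul_assoc, hV,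
      diagonal_mul_diagonal]
    congr 1
    funext i
    exact (hσV i).symm
  have bU : ∀ W : Matrix (Fin m) (Fin m) ℝ, Wᵀ * W = 1 → ∀ i,
      ((Uᵀ * W)ᵀ * (Uᵀ * W)) i i ≤ 1 := by
    intro W hW i
    refine (diag_transpose_mul_self_le U W (by rw [hU1, Matrix.one_mul]) i).trans ?_
    rw [hW, Matrix.one_apply_eq]
  have bV : ∀ (W : Matrix (Fin n) (Fin m) ℝ) (t : Fin m → ℝ),
      Wᵀ * W = diagonal (fun i => if t i = 0 then 0 else 1) → ∀ i,
      ((Vᵀ * W)ᵀ * (Vᵀ * W)) i i ≤ 1 := by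
    intro W t hW i
    refine (diag_transpose_mul_self_le V W hVV i).trans ?_
    rw [hW, diagonal_apply_eq]
    split_ifs <;> norm_num
  have hnn : ∀ (Z : Matrix (Fin m) (Fin n) ℝ) i, 0 ≤ a * sv Z i :=
    fun Z i => mul_nonneg ha.le (sv_nonneg Z i)
  have hXd : Uᵀ * U₁ * diagonal (fun i => a * sv X i) * (Vᵀ * V₁)ᵀ = a • (Uᵀ * X * V) := by
    have : diagonal (fun i => a * sv X i) = a • diagonal (sv X) := diagonal_smul a (sv X)
    conv_rhs => rw [hX]
    rw [this]
    simp [Matrix.mul_assoc]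
  have hYd : Uᵀ * U₂ * diagonal (fun i => a * sv Y i) * (Vᵀ * V₂)ᵀ = a • (Uᵀ * Y * V) := by
    have : diagonal (fun i => a * sv Y i) = a • diagonal (sv Y) := diagonal_smul a (sv Y)
    conv_rhs => rw [hY]
    rw [this]
    simp [Matrix.mul_assoc]
  refine sum_div_add_one_le_of_posSemidef _ _ (fun i => a * sv (X + Y) i) (fun i => a * sv X i)
    (fun i => a * sv Y i) (hnn _) (hnn _) (hnn _)
    (half_sum_diag_le (Uᵀ * U₁) (Vᵀ * V₁) _ (hnn X) (bU U₁ hU₁) (bV V₁ _ hV₁))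
    (half_sum_diag_le (Uᵀ * U₂) (Vᵀ * V₂) _ (hnn Y) (bU U₂ hU₂) (bV V₂ _ hV₂)) ?_
  rw [half_sum_mul_transpose_eq _ _ _ (hnn X), half_sum_mul_transpose_eq _ _ _ (hnn Y), hXd, hYd]
  have hsum : diagonal (fun i => a * sv (X + Y) i)
      = (1 / 2 : ℝ) • (a • (Uᵀ * X * V) + (a • (Uᵀ * X * V))ᵀ)
        + (1 / 2 : ℝ) • (a • (Uᵀ * Y * V) + (a • (Uᵀ * Y * V))ᵀ) := by
    have h1 : diagonal (fun i => a * sv (X + Y) i) = a • (Uᵀ * X * V) + a • (Uᵀ * Y * V) := by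
      rw [← smul_add, ← Matrix.add_mul, ← Matrix.mul_add, ← hSd]
      exact diagonal_smul a (sv (X + Y))
    have h2 := congrArg Matrix.transpose h1
    rw [diagonal_transpose, Matrix.transpose_add] at h2
    have h3 : diagonal (fun i => a * sv (X + Y) i)
        = (1 / 2 : ℝ) • diagonal (fun i => a * sv (X + Y) i)
          + (1 / 2 : ℝ) • diagonal (fun i => a * sv (X + Y) i) := by module
    rw [h3]
    nth_rewrite 1 [h1]
    rw [h2]
    module
  rw [hsum, add_add_add_comm, add_sub_cancel_left]
  simpa only [conjTranspose_eq_transpose_of_trivial] using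
    (posSemidef_self_mul_conjTranspose (_ : Matrix (Fin m) (Fin m) ℝ)).add
      (posSemidef_self_mul_conjTranspose (_ : Matrix (Fin m) (Fin m) ℝ))

lemma Matrix.rank_add_le_rank_add_rank {p q : Type*} [Fintype p] [Fintype q]
    (M N : Matrix p q ℝ) : (M + N).rank ≤ M.rank + N.rank := by
  rw [Matrix.rank, Matrix.rank, Matrix.rank, Matrix.mulVecLin_add]
  exact (Submodule.finrank_mono (LinearMap.range_add_le _ _)).trans
    (Submodule.finrank_add_le_finrank_add_finrank _ _)

lemma exists_projections {m n : ℕ} (X : Matrix (Fin m) (Fin n) ℝ) :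
    ∃ (P : Matrix (Fin m) (Fin m) ℝ) (Q : Matrix (Fin n) (Fin n) ℝ),
      Pᵀ = P ∧ Qᵀ = Q ∧ P * X = X ∧ X * Q = X ∧ P.rank ≤ X.rank ∧ Q.rank ≤ X.rank := by
  obtain ⟨U, V, -, hU, hX, hV⟩ := exists_svd X
  have hrank := rank_diagonal_sv X
  set E : Matrix (Fin m) (Fin m) ℝ := diagonal (fun i => if sv X i = 0 then 0 else 1) with hE
  have hEt : Eᵀ = E := diagonal_transpose _
  have hED : E * diagonal (sv X) = diagonal (sv X) := by
    rw [hE, diagonal_mul_diagonal]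
    congr 1
    funext i
    split_ifs with h <;> simp [h]
  have hDE : diagonal (sv X) * E = diagonal (sv X) := by
    rw [hE, diagonal_mul_diagonal]
    congr 1
    funext i
    split_ifs with h <;> simp [h]
  refine ⟨U * E * Uᵀ, V * Vᵀ, ?_, ?_, ?_, ?_, ?_, ?_⟩
  · simp [Matrix.transpose_mul, hEt, Matrix.mul_assoc]
  · simp [Matrix.transpose_mul]
  · conv_lhs => rw [hX]
    conv_rhs => rw [hX]
    rw [Matrix.mul_assoc, ← Matrix.mul_assoc Uᵀ, ← Matrix.mul_assoc Uᵀ, hU, Matrix.one_mul,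
      Matrix.mul_assoc, ← Matrix.mul_assoc E, hED, Matrix.mul_assoc]
  · conv_lhs => rw [hX]
    conv_rhs => rw [hX]
    rw [Matrix.mul_assoc, ← Matrix.mul_assoc Vᵀ, hV, Matrix.mul_assoc, ← Matrix.mul_assoc _ E, hDE,
      Matrix.mul_assoc]
  · rw [← hrank]
    exact (Matrix.rank_mul_le_left _ _).trans (Matrix.rank_mul_le_right _ _)
  · rw [← hrank, ← hV, ← conjTranspose_eq_transpose_of_trivial, rank_self_mul_conjTranspose,
      rank_conjTranspose_mul_self]

theorem statement4 (m n d : ℕ) (hmn : m ≤ n) (a : ℝ) (ha : 0 < a)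
    (A : Matrix (Fin m) (Fin n) ℝ →ₗ[ℝ] EuclideanSpace ℝ (Fin d))
    (b : EuclideanSpace ℝ (Fin d))
    (X₀ Xstar : Matrix (Fin m) (Fin n) ℝ)
    (hX₀ : A X₀ = b) (hXstar : A Xstar = b)
    (hmin : ∀ X : Matrix (Fin m) (Fin n) ℝ, A X = b → Pa a Xstar ≤ Pa a X) :
    ∃ R₀ Rc : Matrix (Fin m) (Fin n) ℝ,
      Xstar - X₀ = R₀ + Rc ∧
      R₀.rank ≤ 2 * X₀.rank ∧
      X₀ * Rcᵀ = 0 ∧ X₀ᵀ * Rc = 0 ∧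
      Pa a Rc ≤ Pa a R₀ := by
  obtain ⟨P, Q, hPt, hQt, hP, hQ, hPr, hQr⟩ := exists_projections X₀
  obtain ⟨R, hR⟩ : ∃ R, R = Xstar - X₀ := ⟨_, rfl⟩
  have hPX : X₀ᵀ * P = X₀ᵀ := by
    simpa [Matrix.transpose_mul, hPt] using congrArg Matrix.transpose hP
  have h₁ : X₀ * ((1 - P) * R * (1 - Q))ᵀ = 0 := by
    rw [Matrix.transpose_mul, Matrix.transpose_sub, hQt, Matrix.transpose_one, ← Matrix.mul_assoc,
      Matrix.mul_sub, hQ, Matrix.mul_one, sub_self, Matrix.zero_mul]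
  have h₂ : X₀ᵀ * ((1 - P) * R * (1 - Q)) = 0 := by
    rw [← Matrix.mul_assoc, ← Matrix.mul_assoc, Matrix.mul_sub X₀ᵀ, hPX, Matrix.mul_one, sub_self,
      Matrix.zero_mul, Matrix.zero_mul]
  have hsplit : R = (P * R + (1 - P) * R * Q) + (1 - P) * R * (1 - Q) := by
    simp only [Matrix.sub_mul, Matrix.mul_sub, Matrix.one_mul, Matrix.mul_one]
    abel
  refine ⟨P * R + (1 - P) * R * Q, (1 - P) * R * (1 - Q), hR.symm.trans hsplit, ?_, h₁, h₂, ?_⟩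
  · calc _ ≤ (P * R).rank + ((1 - P) * R * Q).rank := Matrix.rank_add_le_rank_add_rank _ _
      _ ≤ X₀.rank + X₀.rank := add_le_add ((Matrix.rank_mul_le_left _ _).trans hPr)
        ((Matrix.rank_mul_le_right _ _).trans hQr)
      _ = _ := by ring
  · have hadd := Pa_add_of_orthogonal a _ _ h₁ h₂
    have hsub := Pa_add_le a ha Xstar (-(P * R + (1 - P) * R * Q))
    have heq : Xstar + -(P * R + (1 - P) * R * Q) = X₀ + (1 - P) * R * (1 - Q) := by
      have : Xstar = X₀ + R := by rw [hR]; abel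
      rw [this]
      nth_rewrite 1 [hsplit]
      abel
    rw [heq, hadd, Pa_neg] at hsub
    have := hmin X₀ hX₀
    linarith
end

section
/- Let 𝒜 : ℝ^{m×n} → ℝ^d (m ≤ n) be a linear map, b ∈ ℝ^d, and let X₀ be an optimal solution of the problem (AMRM) with rank(X₀) = T ≥ 1 and 5T ≤ m. Let a satisfy 1 < a < √(3/2) and suppose δ_{5T}(𝒜) < (3 − 2a²)/(3 + 2a²). Then every global minimizer X* of the problem (TrAMRM) with parameter a satisfies X* = X₀. -/
open Matrix Filter

/-- The transpose of a matrix with orthonormal columns does not increase the norm. -/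
theorem sum_sq_vecMul_le {ι κ : Type*} [Fintype ι] [Fintype κ] [DecidableEq κ]
    {u : Matrix ι κ ℝ} (hu : uᵀ * u = 1) (p : ι → ℝ) :
    ∑ k, ((uᵀ *ᵥ p) k) ^ 2 ≤ ∑ i, p i ^ 2 := by
  set w := uᵀ *ᵥ p with hw
  have h1 : (u *ᵥ w) ⬝ᵥ (u *ᵥ w) = w ⬝ᵥ w := by
    rw [dotProduct_mulVec, vecMul_mulVec, hu, vecMul_one]
  have h2 : p ⬝ᵥ (u *ᵥ w) = w ⬝ᵥ w := by
    rw [dotProduct_mulVec, ← mulVec_transpose]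
  have h3 : 0 ≤ (p - u *ᵥ w) ⬝ᵥ (p - u *ᵥ w) := by
    simp only [dotProduct]
    exact Finset.sum_nonneg fun i _ => mul_self_nonneg _
  have h4 : (u *ᵥ w) ⬝ᵥ p = w ⬝ᵥ w := by rw [dotProduct_comm, h2]
  rw [sub_dotProduct, dotProduct_sub, dotProduct_sub, h1, h2, h4] at h3
  have h5 : ∑ k, w k ^ 2 = w ⬝ᵥ w := by simp [dotProduct, sq]
  have h6 : ∑ i, p i ^ 2 = p ⬝ᵥ p := by simp [dotProduct, sq]
  rw [h5, h6]; linarith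

theorem le_one_div_of_mul_sq_le {q r : ℝ} (hr : 0 < r) (h : r * q ^ 2 ≤ q) : q ≤ 1 / r := by
  rw [le_div_iff₀ hr]
  by_contra! hc
  have hq : 0 < q := by
    by_contra! hq
    nlinarith
  nlinarith

/-- If `diag s ≤ ∑ σ_l c_l c_lᵀ` with columns `c_l` of norm at most one, then
`∑ s / (1 + s) ≤ ∑ σ / (1 + σ)`. -/
theorem sum_div_one_add_le_of_quadForm_le {K L : Type*} [Fintype K] [Fintype L]
    (s : K → ℝ) (σ : L → ℝ) (c : Matrix K L ℝ)
    (hs : ∀ k, 0 ≤ s k) (hσ : ∀ l, 0 ≤ σ l) (hc : ∀ l, ∑ k, c k l ^ 2 ≤ 1)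
    (h : ∀ y : K → ℝ, ∑ k, s k * y k ^ 2 ≤ ∑ l, σ l * ((cᵀ *ᵥ y) l) ^ 2) :
    ∑ k, s k / (1 + s k) ≤ ∑ l, σ l / (1 + σ l) := by
  classical
  set S : Matrix K K ℝ := c * diagonal σ * cᵀ with hS
  have hquad : ∀ y : K → ℝ, y ⬝ᵥ (S *ᵥ y) = ∑ l, σ l * ((cᵀ *ᵥ y) l) ^ 2 := by
    intro y
    rw [hS, ← mulVec_mulVec, ← mulVec_mulVec, dotProduct_mulVec, ← mulVec_transpose]
    simp only [dotProduct, mulVec_diagonal]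
    exact Finset.sum_congr rfl fun l _ => by ring
  have hquad1 : ∀ y : K → ℝ, y ⬝ᵥ ((1 + S) *ᵥ y) =
      ∑ k, y k ^ 2 + ∑ l, σ l * ((cᵀ *ᵥ y) l) ^ 2 := by
    intro y
    rw [add_mulVec, dotProduct_add, hquad, one_mulVec]
    simp [dotProduct, sq]
  have hdet : IsUnit (1 + S) := by
    rw [← Matrix.mulVec_injective_iff_isUnit]
    intro y z hyz
    have h0 : (1 + S) *ᵥ (y - z) = 0 := by rw [mulVec_sub]; exact sub_eq_zero.2 hyz
    have h1 := hquad1 (y - z)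
    rw [h0, dotProduct_zero] at h1
    have h2 : 0 ≤ ∑ l, σ l * ((cᵀ *ᵥ (y - z)) l) ^ 2 :=
      Finset.sum_nonneg fun l _ => mul_nonneg (hσ l) (sq_nonneg _)
    have h3 : ∑ k, (y - z) k ^ 2 = 0 :=
      le_antisymm (by linarith) (Finset.sum_nonneg fun k _ => sq_nonneg _)
    rw [Finset.sum_eq_zero_iff_of_nonneg fun k _ => sq_nonneg _] at h3
    funext k
    have := h3 k (Finset.mem_univ k)
    simpa [sub_eq_zero] using this
  have hdet' : IsUnit (1 + S).det := (Matrix.isUnit_iff_isUnit_det _).1 hdet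
  set M := (1 + S)⁻¹ with hM
  have hMr : (1 + S) * M = 1 := Matrix.mul_nonsing_inv _ hdet'
  have key : ∀ z : K → ℝ, (M *ᵥ z) ⬝ᵥ z =
      ∑ k, (M *ᵥ z) k ^ 2 + ∑ l, σ l * ((cᵀ *ᵥ (M *ᵥ z)) l) ^ 2 := by
    intro z
    rw [← hquad1, mulVec_mulVec, hMr, one_mulVec]
  have hdiag : ∀ k, M k k ≤ 1 / (1 + s k) := by
    intro k
    have h1 := key (Pi.single k 1)
    have hk : ∀ i, (M *ᵥ Pi.single k 1) i = M i k := by intro i; simp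
    rw [dotProduct_single, hk, mul_one] at h1
    have h2 := h (M *ᵥ Pi.single k 1)
    have h3 : (M k k) ^ 2 ≤ ∑ i, (M *ᵥ Pi.single k 1) i ^ 2 := by
      rw [← hk k]
      exact Finset.single_le_sum (f := fun i => (M *ᵥ Pi.single k 1) i ^ 2)
        (fun i _ => sq_nonneg _) (Finset.mem_univ k)
    have h4 : s k * (M k k) ^ 2 ≤ ∑ i, s i * (M *ᵥ Pi.single k 1) i ^ 2 := by
      rw [← hk k]
      exact Finset.single_le_sum (f := fun i => s i * (M *ᵥ Pi.single k 1) i ^ 2)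
        (fun i _ => mul_nonneg (hs i) (sq_nonneg _)) (Finset.mem_univ k)
    apply le_one_div_of_mul_sq_le (by linarith [hs k])
    linarith
  have hcol : ∀ l, (cᵀ * M * c) l l ≤ 1 / (1 + σ l) := by
    intro l
    set z : K → ℝ := fun k => c k l with hz
    set y := M *ᵥ z with hy
    have h1 := key z
    have hq : (cᵀ * M * c) l l = y ⬝ᵥ z := by
      rw [Matrix.mul_assoc, dotProduct_comm]
      rfl
    have hq' : (cᵀ *ᵥ y) l = y ⬝ᵥ z := by rw [dotProduct_comm]; rfl
    rw [hq]
    have h3 : σ l * (y ⬝ᵥ z) ^ 2 ≤ ∑ i, σ i * ((cᵀ *ᵥ y) i) ^ 2 := by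
      rw [← hq']
      exact Finset.single_le_sum (f := fun i => σ i * ((cᵀ *ᵥ y) i) ^ 2)
        (fun i _ => mul_nonneg (hσ i) (sq_nonneg _)) (Finset.mem_univ l)
    have h4 : (y ⬝ᵥ z) ^ 2 ≤ (∑ k, y k ^ 2) * ∑ k, z k ^ 2 :=
      Finset.sum_mul_sq_le_sq_mul_sq _ _ _
    have h5 : (∑ k, y k ^ 2) * ∑ k, z k ^ 2 ≤ ∑ k, y k ^ 2 :=
      mul_le_of_le_one_right (Finset.sum_nonneg fun k _ => sq_nonneg _) (hc l)
    apply le_one_div_of_mul_sq_le (by linarith [hσ l])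
    linarith
  have htr : (S * M).trace = ∑ l, σ l * (cᵀ * M * c) l l := by
    rw [hS, Matrix.mul_assoc (c * diagonal σ), Matrix.mul_assoc c, trace_mul_comm c,
      Matrix.mul_assoc (diagonal σ), trace]
    simp [diagonal_mul]
  have htr2 : M.trace + (S * M).trace = Fintype.card K := by
    rw [← trace_add, ← Matrix.trace_one (R := ℝ), ← hMr, Matrix.add_mul, Matrix.one_mul]
  have h1 : M.trace ≤ ∑ k, 1 / (1 + s k) := Finset.sum_le_sum fun k _ => hdiag k
  have h2 : (S * M).trace ≤ ∑ l, σ l / (1 + σ l) := by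
    rw [htr]
    refine Finset.sum_le_sum fun l _ => ?_
    have := mul_le_mul_of_nonneg_left (hcol l) (hσ l)
    rwa [mul_one_div] at this
  have h3 : ∑ k, s k / (1 + s k) = Fintype.card K - ∑ k, 1 / (1 + s k) := by
    rw [eq_sub_iff_add_eq, ← Finset.sum_add_distrib]
    rw [Finset.sum_congr rfl (g := fun _ => (1 : ℝ))]
    · simp
    · intro k _
      have : 1 + s k ≠ 0 := by linarith [hs k]
      field_simp
      ring
  linarith

/-- The Rotfeld inequality for `t ↦ t / (1 + t)`: the sum over the singular values of a matrix is at
most the sum over the weights of any expansion into rank-one matrices of norm at most one. -/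
theorem sum_div_one_add_le_of_svd_eq {ι κ K L : Type*} [Fintype ι] [Fintype κ] [Fintype K]
    [Fintype L] [DecidableEq K] [DecidableEq L]
    (u : Matrix ι K ℝ) (v : Matrix κ K ℝ) (s : K → ℝ) (hu : uᵀ * u = 1) (hv : vᵀ * v = 1)
    (hs : ∀ k, 0 ≤ s k)
    (p : Matrix ι L ℝ) (q : Matrix κ L ℝ) (σ : L → ℝ) (hp : ∀ l, ∑ i, p i l ^ 2 ≤ 1)
    (hq : ∀ l, ∑ i, q i l ^ 2 ≤ 1) (hσ : ∀ l, 0 ≤ σ l)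
    (h : u * diagonal s * vᵀ = p * diagonal σ * qᵀ) :
    ∑ k, s k / (1 + s k) ≤ ∑ l, σ l / (1 + σ l) := by
  refine sum_div_one_add_le_of_quadForm_le s σ ((1 / 2 : ℝ) • (uᵀ * p + vᵀ * q)) hs hσ ?_ ?_
  · intro l
    have h1 := (sum_sq_vecMul_le hu (fun i => p i l)).trans (hp l)
    have h2 := (sum_sq_vecMul_le hv (fun i => q i l)).trans (hq l)
    have h3 : ∑ k, ((1 / 2 : ℝ) • (uᵀ * p + vᵀ * q)) k l ^ 2 ≤
        ∑ k, (1 / 2 * (uᵀ *ᵥ fun i => p i l) k ^ 2 + 1 / 2 * (vᵀ *ᵥ fun i => q i l) k ^ 2) := by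
      refine Finset.sum_le_sum fun k _ => ?_
      have e1 : (uᵀ * p) k l = (uᵀ *ᵥ fun i => p i l) k := rfl
      have e2 : (vᵀ * q) k l = (vᵀ *ᵥ fun i => q i l) k := rfl
      rw [Matrix.smul_apply, Matrix.add_apply, e1, e2, smul_eq_mul]
      nlinarith [sq_nonneg ((uᵀ *ᵥ fun i => p i l) k - (vᵀ *ᵥ fun i => q i l) k)]
    rw [Finset.sum_add_distrib, ← Finset.mul_sum, ← Finset.mul_sum] at h3
    linarith
  · intro y
    have hD : diagonal s = uᵀ * p * diagonal σ * (qᵀ * v) := by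
      calc diagonal s = (uᵀ * u) * diagonal s * (vᵀ * v) := by rw [hu, hv]; simp
        _ = uᵀ * (u * diagonal s * vᵀ) * v := by simp only [Matrix.mul_assoc]
        _ = _ := by rw [h]; simp only [Matrix.mul_assoc]
    have e1 : ∑ k, s k * y k ^ 2 = y ⬝ᵥ (diagonal s *ᵥ y) := by
      simp only [dotProduct, mulVec_diagonal]
      exact Finset.sum_congr rfl fun l _ => by ring
    have e2 : y ⬝ᵥ (diagonal s *ᵥ y) =
        ∑ l, σ l * (((uᵀ * p)ᵀ *ᵥ y) l * ((qᵀ * v) *ᵥ y) l) := by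
      rw [hD, ← mulVec_mulVec, ← mulVec_mulVec, dotProduct_mulVec, ← mulVec_transpose]
      simp only [dotProduct, mulVec_diagonal]
      exact Finset.sum_congr rfl fun l _ => by ring
    rw [e1, e2]
    refine Finset.sum_le_sum fun l _ => mul_le_mul_of_nonneg_left ?_ (hσ l)
    have e3 : (((1 / 2 : ℝ) • (uᵀ * p + vᵀ * q))ᵀ *ᵥ y) l =
        1 / 2 * (((uᵀ * p)ᵀ *ᵥ y) l + ((qᵀ * v) *ᵥ y) l) := by
      rw [transpose_smul, transpose_add, smul_mulVec, add_mulVec]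
      simp [transpose_mul]
    rw [e3]
    nlinarith [sq_nonneg (((uᵀ * p)ᵀ *ᵥ y) l - ((qᵀ * v) *ᵥ y) l)]

theorem exists_equiv_antitone_comp {J : Type*} [Fintype J] {N : ℕ} (hN : N = Fintype.card J)
    (τ : J → ℝ) : ∃ e : Fin N ≃ J, Antitone (τ ∘ e) := by
  subst hN
  let f := (Fintype.equivFin J).symm
  let g : Fin (Fintype.card J) → ℝ := fun i => -τ (f i)
  refine ⟨(Tuple.sort g).trans f, fun i j hij => ?_⟩
  have := Tuple.monotone_sort g hij
  simp only [Function.comp_apply, g] at this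
  simpa using this

/-- Compact singular value decomposition, with singular values in descending order. -/
theorem exists_compact_svd {m n : ℕ} (X : Matrix (Fin m) (Fin n) ℝ) :
    ∃ (N : ℕ) (s : Fin N → ℝ) (u : Matrix (Fin m) (Fin N) ℝ) (v : Matrix (Fin n) (Fin N) ℝ),
      N = X.rank ∧ Antitone s ∧ (∀ k, 0 < s k) ∧ uᵀ * u = 1 ∧ vᵀ * v = 1 ∧ X = u * diagonal s * vᵀ ∧
      ∀ f : ℝ → ℝ, f 0 = 0 → ∑ i, f (sv X i) = ∑ k, f (s k) := by
  set hA := Matrix.isHermitian_mul_conjTranspose_self X with hhA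
  have hnn : ∀ i, 0 ≤ hA.eigenvalues i :=
    (posSemidef_self_mul_conjTranspose X).eigenvalues_nonneg
  have hr : X.rank = Fintype.card {i // hA.eigenvalues i ≠ 0} := by
    rw [← hA.rank_eq_card_non_zero_eigs, rank_self_mul_conjTranspose]
  obtain ⟨e, he⟩ := exists_equiv_antitone_comp hr (fun i => sv X i)
  set E : Matrix (Fin m) (Fin m) ℝ := (hA.eigenvectorUnitary : unitaryGroup (Fin m) ℝ).1 with hE
  have hE1 : Eᵀ * E = 1 := by
    have := Unitary.coe_star_mul_self hA.eigenvectorUnitary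
    rwa [star_eq_conjTranspose, conjTranspose_eq_transpose_of_trivial] at this
  have hE2 : E * Eᵀ = 1 := mul_eq_one_comm.1 hE1
  have hD : Eᵀ * (X * Xᵀ) * E = diagonal hA.eigenvalues := by
    have := hA.conjStarAlgAut_star_eigenvectorUnitary
    rw [Unitary.conjStarAlgAut_star_apply, star_eq_conjTranspose,
      conjTranspose_eq_transpose_of_trivial] at this
    rw [← conjTranspose_eq_transpose_of_trivial X]
    exact this
  have hsq : ∀ i, sv X i ^ 2 = hA.eigenvalues i := fun i => Real.sq_sqrt (hnn i)
  have hspos : ∀ k, 0 < sv X (e k) := fun k =>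
    Real.sqrt_pos.2 (lt_of_le_of_ne (hnn _) (e k).2.symm)
  have hinj : Function.Injective fun k => (e k : Fin m) :=
    Subtype.val_injective.comp e.injective
  have hsum : ∀ f : Fin m → ℝ, (∀ i, hA.eigenvalues i = 0 → f i = 0) →
      ∑ i, f i = ∑ k, f (e k) := by
    intro f hf
    rw [Equiv.sum_comp e (fun i => f i), ← Finset.sum_subtype
      (Finset.univ.filter fun i => hA.eigenvalues i ≠ 0) (by simp) f]
    exact (Finset.sum_filter_of_ne (p := fun i => hA.eigenvalues i ≠ 0)
      fun i _ hi h0 => hi (hf i h0)).symm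
  set u : Matrix (Fin m) (Fin X.rank) ℝ := E.submatrix id (fun k => (e k : Fin m)) with hu
  set s : Fin X.rank → ℝ := fun k => sv X (e k) with hs
  have huu : uᵀ * u = 1 := by
    have : uᵀ * u = (Eᵀ * E).submatrix (fun k => (e k : Fin m)) (fun k => (e k : Fin m)) := by
      rw [hu, transpose_submatrix, ← submatrix_mul _ _ _ id _ Function.bijective_id]
    rw [this, hE1, submatrix_one _ hinj]
  have huX : uᵀ * (X * Xᵀ) * u = diagonal (fun k => s k ^ 2) := by
    have : uᵀ * (X * Xᵀ) * u =
        (Eᵀ * (X * Xᵀ) * E).submatrix (fun k => (e k : Fin m)) (fun k => (e k : Fin m)) := by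
      ext i j
      simp [hu, Matrix.mul_apply]
    rw [this, hD, submatrix_diagonal _ _ hinj]
    congr 1
    funext k
    exact (hsq _).symm
  have hzero : ∀ i, hA.eigenvalues i = 0 → ∀ j, (Eᵀ * X) i j = 0 := by
    intro i hi j
    have h1 : ((Eᵀ * X) * (Eᵀ * X)ᵀ) i i = 0 := by
      have : (Eᵀ * X) * (Eᵀ * X)ᵀ = Eᵀ * (X * Xᵀ) * E := by
        rw [transpose_mul, transpose_transpose]; simp only [Matrix.mul_assoc]
      rw [this, hD, diagonal_apply_eq, hi]
    rw [Matrix.mul_apply] at h1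
    simp only [transpose_apply (Eᵀ * X)] at h1
    rw [Finset.sum_eq_zero_iff_of_nonneg fun _ _ => mul_self_nonneg _] at h1
    exact mul_self_eq_zero.1 (h1 j (Finset.mem_univ j))
  have hproj : u * (uᵀ * X) = X := by
    have h1 : E * (Eᵀ * X) = X := by rw [← Matrix.mul_assoc, hE2, Matrix.one_mul]
    ext i j
    rw [← congrFun (congrFun h1 i) j, Matrix.mul_apply, Matrix.mul_apply (M := E),
      hsum (fun l => E i l * (Eᵀ * X) l j) fun l hl => by rw [hzero l hl, mul_zero]]
    rfl
  have hinv : diagonal s * diagonal (fun k => (s k)⁻¹) = 1 := by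
    rw [diagonal_mul_diagonal, ← diagonal_one]
    congr 1
    funext k
    exact mul_inv_cancel₀ (hspos k).ne'
  refine ⟨X.rank, s, u, Xᵀ * u * diagonal (fun k => (s k)⁻¹), rfl, he, hspos, huu, ?_, ?_, ?_⟩
  · rw [transpose_mul, transpose_mul, transpose_transpose, diagonal_transpose]
    have : diagonal (fun k => (s k)⁻¹) * (uᵀ * X) * (Xᵀ * u * diagonal fun k => (s k)⁻¹) =
        diagonal (fun k => (s k)⁻¹) * (uᵀ * (X * Xᵀ) * u) * diagonal (fun k => (s k)⁻¹) := by
      simp only [Matrix.mul_assoc]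
    rw [this, huX, diagonal_mul_diagonal, diagonal_mul_diagonal, ← diagonal_one]
    congr 1
    funext k
    have := (hspos k).ne'
    simp only [hs]
    field_simp
  · rw [transpose_mul, transpose_mul, transpose_transpose, diagonal_transpose,
      Matrix.mul_assoc u, ← Matrix.mul_assoc (diagonal s), hinv, Matrix.one_mul, hproj]
  · intro f hf
    exact hsum (fun i => f (sv X i)) fun i hi => by
      simp only [sv, hi, Real.sqrt_zero, hf]

theorem Matrix.rank_add_le_rank_add_rank_s10 {m n : ℕ} (A B : Matrix (Fin m) (Fin n) ℝ) :
    (A + B).rank ≤ A.rank + B.rank := by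
  refine le_trans (Submodule.finrank_mono ?_) (Submodule.finrank_add_le_finrank_add_finrank _ _)
  rintro _ ⟨x, rfl⟩
  rw [mulVecLin_add]
  exact Submodule.add_mem_sup (LinearMap.mem_range_self _ x) (LinearMap.mem_range_self _ x)

theorem rank_mul_diagonal_mul_le {ι κ K : Type*} [Fintype ι] [Fintype κ] [Fintype K]
    [DecidableEq K] (u : Matrix ι K ℝ) (t : K → ℝ) (v : Matrix K κ ℝ) :
    (u * diagonal t * v).rank ≤ (Finset.univ.filter fun k => t k ≠ 0).card := by
  classical
  refine (rank_mul_le_left _ _).trans ((rank_mul_le_right _ _).trans ?_)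
  rw [rank_diagonal, Fintype.card_subtype]

theorem trace_transpose_mul_self_svd {ι κ K : Type*} [Fintype ι] [Fintype κ] [Fintype K]
    [DecidableEq K] {u : Matrix ι K ℝ} {v : Matrix κ K ℝ} (hu : uᵀ * u = 1) (hv : vᵀ * v = 1)
    (t : K → ℝ) :
    ((u * diagonal t * vᵀ)ᵀ * (u * diagonal t * vᵀ)).trace = ∑ k, t k ^ 2 := by
  have : (u * diagonal t * vᵀ)ᵀ * (u * diagonal t * vᵀ) =
      v * (diagonal t * (uᵀ * u) * diagonal t * vᵀ) := by
    simp only [transpose_mul, transpose_transpose, diagonal_transpose, Matrix.mul_assoc]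
  rw [this, hu, trace_mul_comm, Matrix.mul_assoc, hv]
  simp [trace_diagonal, sq]

theorem sum_range_mul_eq {f : ℕ → ℝ} (q N : ℕ) :
    ∑ k ∈ Finset.range (q * N), f k =
      ∑ l ∈ Finset.range N, ∑ r ∈ Finset.range q, f (q * l + r) := by
  induction N with
  | zero => simp
  | succ N ih => rw [Nat.mul_succ, Finset.sum_range_add, ih, Finset.sum_range_succ]

/-- Jensen's inequality for `t ↦ a t / (a t + 1)`, over at most `c` points. -/
theorem sum_fraction_le_of_card_le {K : Type*} [Fintype K] {a c x : ℝ} (ha : 0 < a)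
    (ρ : K → ℝ) (hρ : ∀ k, 0 ≤ ρ k) (hc : (Fintype.card K : ℝ) ≤ c) (hx : 0 ≤ x)
    (hsum : ∑ k, ρ k ≤ c * x) :
    ∑ k, a * ρ k / (a * ρ k + 1) ≤ c * (a * x / (a * x + 1)) := by
  have hx1 : 0 < a * x + 1 := by positivity
  have htangent : ∀ k, a * ρ k / (a * ρ k + 1) ≤
      (a * x / (a * x + 1)) ^ 2 + a / (a * x + 1) ^ 2 * ρ k := by
    intro k
    have hk : 0 < a * ρ k + 1 := by have := hρ k; positivity
    rw [div_pow, div_mul_eq_mul_div, ← add_div, div_le_div_iff₀ hk (by positivity)]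
    nlinarith [sq_nonneg (a * ρ k - a * x)]
  calc ∑ k, a * ρ k / (a * ρ k + 1)
      ≤ ∑ k, ((a * x / (a * x + 1)) ^ 2 + a / (a * x + 1) ^ 2 * ρ k) :=
        Finset.sum_le_sum fun k _ => htangent k
    _ = Fintype.card K * (a * x / (a * x + 1)) ^ 2 + a / (a * x + 1) ^ 2 * ∑ k, ρ k := by
        rw [Finset.sum_add_distrib, ← Finset.mul_sum]; simp
    _ ≤ c * (a * x / (a * x + 1)) ^ 2 + a / (a * x + 1) ^ 2 * (c * x) := by gcongr
    _ = c * (a * x / (a * x + 1)) := by field_simp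

theorem sum_block_heads_le {a : ℝ} (ha : 0 < a) {T N : ℕ} (hT : 0 < T) {t : ℕ → ℝ}
    (ht : Antitone t) (ht0 : ∀ k, 0 ≤ t k) {x : ℝ} (hx : 0 ≤ x)
    (h : ∑ k ∈ Finset.range (3 * T * N), a * t k / (a * t k + 1) ≤
      2 * T * (a * x / (a * x + 1))) :
    ∑ l ∈ Finset.range N, t (3 * T * (l + 1)) ≤ 2 / 3 * x := by
  have hTr : (0 : ℝ) < T := Nat.cast_pos.2 hT
  have hx1 : 0 < a * x + 1 := by positivity
  have hf0 : ∀ k, 0 ≤ a * t k / (a * t k + 1) := fun k => by have := ht0 k; positivity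
  have hmono : ∀ {p q : ℝ}, 0 ≤ p → p ≤ q → a * p / (a * p + 1) ≤ a * q / (a * q + 1) := by
    intro p q hp hpq
    have : 0 ≤ q := hp.trans hpq
    rw [div_le_div_iff₀ (by positivity) (by positivity)]
    nlinarith
  have hblock : ∀ l, 3 * T * (a * t (3 * T * (l + 1)) / (a * t (3 * T * (l + 1)) + 1)) ≤
      ∑ r ∈ Finset.range (3 * T), a * t (3 * T * l + r) / (a * t (3 * T * l + r) + 1) := by
    intro l
    have := Finset.card_nsmul_le_sum (Finset.range (3 * T))
      (fun r => a * t (3 * T * l + r) / (a * t (3 * T * l + r) + 1))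
      (a * t (3 * T * (l + 1)) / (a * t (3 * T * (l + 1)) + 1)) fun r hr =>
        hmono (ht0 _) (ht (by rw [Nat.mul_succ]; have := Finset.mem_range.1 hr; omega))
    simpa using this
  have hsum : 3 * T * ∑ l ∈ Finset.range N,
      (a * t (3 * T * (l + 1)) / (a * t (3 * T * (l + 1)) + 1)) ≤
      2 * T * (a * x / (a * x + 1)) := by
    refine le_trans ?_ h
    rw [sum_range_mul_eq (f := fun k => a * t k / (a * t k + 1)), Finset.mul_sum]
    exact Finset.sum_le_sum fun l _ => hblock l
  have hle : ∀ l ∈ Finset.range N, t (3 * T * (l + 1)) ≤ x := by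
    intro l hl
    by_contra! hc
    have h1 := Finset.single_le_sum (f := fun l =>
      a * t (3 * T * (l + 1)) / (a * t (3 * T * (l + 1)) + 1)) (fun l _ => hf0 _) hl
    have h2 := hmono hx hc.le
    have h3 : 0 < a * t (3 * T * (l + 1)) / (a * t (3 * T * (l + 1)) + 1) := by
      have : 0 < t (3 * T * (l + 1)) := hx.trans_lt hc
      positivity
    nlinarith
  have hchord : ∀ l ∈ Finset.range N, a / (a * x + 1) * t (3 * T * (l + 1)) ≤
      a * t (3 * T * (l + 1)) / (a * t (3 * T * (l + 1)) + 1) := by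
    intro l hl
    have h0 := ht0 (3 * T * (l + 1))
    rw [div_mul_eq_mul_div]
    exact div_le_div_of_nonneg_left (by positivity) (by positivity)
      (by have := hle l hl; gcongr)
  have h4 := Finset.sum_le_sum hchord
  rw [← Finset.mul_sum] at h4
  set Q := ∑ l ∈ Finset.range N, t (3 * T * (l + 1))
  have h5 : 3 * T * (a / (a * x + 1) * Q) ≤ 2 * T * (a * x / (a * x + 1)) :=
    (mul_le_mul_of_nonneg_left h4 (by positivity)).trans hsum
  have h6 : 3 * T * (a / (a * x + 1) * Q) = (T * a / (a * x + 1)) * (3 * Q) := by ring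
  have h7 : 2 * T * (a * x / (a * x + 1)) = (T * a / (a * x + 1)) * (2 * x) := by ring
  rw [h6, h7] at h5
  have := le_of_mul_le_mul_left h5 (by positivity)
  linarith

theorem card_filter_div_eq_le {N q : ℕ} (l : ℕ) (hq : 0 < q) :
    (Finset.univ.filter fun k : Fin N => (k : ℕ) / q = l).card ≤ q := by
  have := Finset.card_le_card_of_injOn
    (s := Finset.univ.filter fun k : Fin N => (k : ℕ) / q = l)
    (t := Finset.Ico (l * q) ((l + 1) * q)) (fun k => (k : ℕ))
    (fun k hk => by
      have hk' : (k : ℕ) / q = l := by simpa using hk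
      rw [Finset.mem_coe, Finset.mem_Ico, ← hk']
      exact ⟨Nat.div_mul_le_self _ _, (Nat.div_lt_iff_lt_mul hq).1 (Nat.lt_succ_self _)⟩)
    (fun i _ j _ hij => Fin.ext hij)
  rw [Nat.card_Ico, ← Nat.sub_mul] at this
  simpa using this

/-- If `∑ f(s) ≤ ∑ f(ρ)` for `f(t) = a t / (a t + 1)`, with `s` descending and at most `2T`
numbers `ρ`, then the `ℓ²` norms of the blocks of `3T` consecutive entries of `s` after the first
one sum to at most `√(2/3) ‖ρ‖₂`. -/
theorem sum_block_norms_le {a : ℝ} (ha : 0 < a) {T N : ℕ} (hT : 0 < T) {s : Fin N → ℝ}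
    (hs : Antitone s) (hs0 : ∀ k, 0 < s k) {K : Type*} [Fintype K] {ρ : K → ℝ}
    (hρ : ∀ k, 0 ≤ ρ k) (hK : Fintype.card K ≤ 2 * T)
    (h : ∑ k, a * s k / (a * s k + 1) ≤ ∑ k, a * ρ k / (a * ρ k + 1)) :
    ∑ l ∈ Finset.range N, √(∑ k : Fin N, (if (k : ℕ) / (3 * T) = l + 1 then s k else 0) ^ 2) ≤
      √(2 / 3) * √(∑ k, ρ k ^ 2) := by
  have hTr : (0 : ℝ) < T := Nat.cast_pos.2 hT
  have hKr : (Fintype.card K : ℝ) ≤ 2 * T := by exact_mod_cast hK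
  set t : ℕ → ℝ := fun k => if hk : k < N then s ⟨k, hk⟩ else 0 with ht
  have ht0 : ∀ k, 0 ≤ t k := by
    intro k
    simp only [ht]
    split_ifs with hk
    · exact (hs0 _).le
    · exact le_rfl
  have htanti : Antitone t := by
    intro i j hij
    simp only [ht]
    split_ifs with hj hi hi
    · exact hs (by simpa using hij)
    · omega
    · exact (hs0 _).le
    · exact le_rfl
  have hts : ∀ k : Fin N, t k = s k := fun k => by simp [ht]
  set x : ℝ := (∑ k, ρ k) / (2 * T) with hxdef
  have hρsum : 0 ≤ ∑ k, ρ k := Finset.sum_nonneg fun k _ => hρ k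
  have hx : 0 ≤ x := by positivity
  have hjensen := sum_fraction_le_of_card_le ha ρ hρ hKr hx
    (by rw [hxdef]; field_simp; exact le_rfl)
  have hNle : N ≤ 3 * T * N := Nat.le_mul_of_pos_left N (by omega)
  have hfs : ∑ k ∈ Finset.range (3 * T * N), a * t k / (a * t k + 1) =
      ∑ k, a * s k / (a * s k + 1) := by
    rw [← Finset.sum_subset (Finset.range_mono hNle)]
    · rw [← Fin.sum_univ_eq_sum_range (fun k => a * t k / (a * t k + 1))]
      simp only [hts]
    · intro k _ hk
      have : ¬ k < N := by simpa using hk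
      simp [ht, this]
  have hheads := sum_block_heads_le ha hT htanti ht0 hx (hfs.trans_le (h.trans hjensen))
  have hblock : ∀ l, √(∑ k : Fin N, (if (k : ℕ) / (3 * T) = l + 1 then s k else 0) ^ 2) ≤
      √(3 * T) * t (3 * T * (l + 1)) := by
    intro l
    have hcard := card_filter_div_eq_le (N := N) (q := 3 * T) (l + 1) (by omega)
    rw [← Real.sqrt_sq (ht0 (3 * T * (l + 1))), ← Real.sqrt_mul (by positivity)]
    apply Real.sqrt_le_sqrt
    calc ∑ k : Fin N, (if (k : ℕ) / (3 * T) = l + 1 then s k else 0) ^ 2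
        ≤ ∑ k : Fin N, (if (k : ℕ) / (3 * T) = l + 1 then t (3 * T * (l + 1)) ^ 2 else 0) := by
          refine Finset.sum_le_sum fun k _ => ?_
          split_ifs with hk
          · have h1 : 3 * T * (l + 1) ≤ k := by rw [← hk]; exact Nat.mul_div_le _ _
            have h2 := htanti h1
            rw [hts] at h2
            exact pow_le_pow_left₀ (hs0 k).le h2 2
          · simp
      _ = (Finset.univ.filter fun k : Fin N => (k : ℕ) / (3 * T) = l + 1).card *
            t (3 * T * (l + 1)) ^ 2 := by
          rw [← Finset.sum_filter, Finset.sum_const, nsmul_eq_mul]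
      _ ≤ 3 * T * t (3 * T * (l + 1)) ^ 2 := by
          gcongr
          exact_mod_cast hcard
  have hcs : ∑ k, ρ k ≤ √(2 * T) * √(∑ k, ρ k ^ 2) := by
    rw [← Real.sqrt_mul (by positivity)]
    apply Real.le_sqrt_of_sq_le
    calc (∑ k, ρ k) ^ 2 ≤ Fintype.card K * ∑ k, ρ k ^ 2 := by
          simpa using sq_sum_le_card_mul_sum_sq (s := Finset.univ) (f := ρ)
      _ ≤ _ := by gcongr
  calc _ ≤ ∑ l ∈ Finset.range N, √(3 * T) * t (3 * T * (l + 1)) :=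
        Finset.sum_le_sum fun l _ => hblock l
    _ ≤ √(3 * T) * (2 / 3 * x) := by
        rw [← Finset.mul_sum]; gcongr
    _ ≤ √(3 * T) * (2 / 3 * ((√(2 * T) * √(∑ k, ρ k ^ 2)) / (2 * T))) := by
        rw [hxdef]; gcongr
    _ = √(2 / 3) * √(∑ k, ρ k ^ 2) := by
        have h1 : √(3 * T) * √(2 * T) = √(2 / 3) * (3 * T) := by
          rw [← Real.sqrt_mul (by positivity), Real.sqrt_eq_iff_mul_self_eq (by positivity)
            (by positivity)]
          have : √(2 / 3) * √(2 / 3) = (2 / 3 : ℝ) := Real.mul_self_sqrt (by norm_num)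
          linear_combination (-9 * (T : ℝ) ^ 2) * this
        calc _ = (√(3 * T) * √(2 * T)) * (√(∑ k, ρ k ^ 2) / (3 * T)) := by ring
          _ = _ := by rw [h1]; field_simp

theorem sq_frobNorm {m n : ℕ} (X : Matrix (Fin m) (Fin n) ℝ) :
    frobNorm X ^ 2 = (Xᵀ * X).trace := by
  have h : 0 ≤ ∑ i, ∑ j, X i j ^ 2 :=
    Finset.sum_nonneg fun _ _ => Finset.sum_nonneg fun _ _ => sq_nonneg _
  rw [frobNorm, Real.sq_sqrt h, Finset.sum_comm]
  simp [trace, Matrix.mul_apply, sq]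

theorem frobNorm_nonneg {m n : ℕ} (X : Matrix (Fin m) (Fin n) ℝ) : 0 ≤ frobNorm X :=
  Real.sqrt_nonneg _

theorem eq_zero_of_frobNorm_eq_zero {m n : ℕ} {X : Matrix (Fin m) (Fin n) ℝ}
    (h : frobNorm X = 0) : X = 0 := by
  have h1 := sq_frobNorm X
  rw [h, ← conjTranspose_eq_transpose_of_trivial] at h1
  exact trace_conjTranspose_mul_self_eq_zero_iff.1 (by rw [← h1]; norm_num)

theorem frobNorm_svd {m n : ℕ} {K : Type*} [Fintype K] [DecidableEq K]
    {u : Matrix (Fin m) K ℝ} {v : Matrix (Fin n) K ℝ} (hu : uᵀ * u = 1) (hv : vᵀ * v = 1)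
    (t : K → ℝ) : frobNorm (u * diagonal t * vᵀ) = √(∑ k, t k ^ 2) := by
  rw [← trace_transpose_mul_self_svd hu hv, ← sq_frobNorm, Real.sqrt_sq (frobNorm_nonneg _)]

theorem exists_rip_bound_lt {m n d : ℕ}
    (A : Matrix (Fin m) (Fin n) ℝ →ₗ[ℝ] EuclideanSpace ℝ (Fin d)) {r : ℕ} {c : ℝ}
    (h : ripConst A r < c) :
    ∃ δ < c, 0 ≤ δ ∧ ∀ X : Matrix (Fin m) (Fin n) ℝ, X.rank ≤ r →
      (1 - δ) * frobNorm X ^ 2 ≤ ‖A X‖ ^ 2 ∧ ‖A X‖ ^ 2 ≤ (1 + δ) * frobNorm X ^ 2 := by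
  set C := ∑ i, ∑ j, ‖A (Matrix.single i j 1)‖ with hC
  have hC0 : 0 ≤ C := Finset.sum_nonneg fun _ _ => Finset.sum_nonneg fun _ _ => norm_nonneg _
  have hentry : ∀ (X : Matrix (Fin m) (Fin n) ℝ) i j, |X i j| ≤ frobNorm X := by
    intro X i j
    apply Real.abs_le_sqrt
    exact (Finset.single_le_sum (f := fun j => X i j ^ 2) (fun _ _ => sq_nonneg _)
      (Finset.mem_univ j)).trans (Finset.single_le_sum (f := fun i => ∑ j, X i j ^ 2)
        (fun _ _ => Finset.sum_nonneg fun _ _ => sq_nonneg _) (Finset.mem_univ i))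
  have hbound : ∀ X, ‖A X‖ ≤ C * frobNorm X := by
    intro X
    have hX : A X = ∑ i, ∑ j, X i j • A (Matrix.single i j 1) := by
      conv_lhs => rw [matrix_eq_sum_single X]
      simp only [map_sum, ← map_smul, smul_single, smul_eq_mul, mul_one]
    rw [hX, hC, Finset.sum_mul]
    refine (norm_sum_le _ _).trans (Finset.sum_le_sum fun i _ => ?_)
    rw [Finset.sum_mul]
    refine (norm_sum_le _ _).trans (Finset.sum_le_sum fun j _ => ?_)
    rw [norm_smul, mul_comm]
    exact mul_le_mul_of_nonneg_left (hentry X i j) (norm_nonneg _)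
  have hne : {δ : ℝ | 0 ≤ δ ∧ ∀ X : Matrix (Fin m) (Fin n) ℝ, X.rank ≤ r →
      (1 - δ) * frobNorm X ^ 2 ≤ ‖A X‖ ^ 2 ∧
        ‖A X‖ ^ 2 ≤ (1 + δ) * frobNorm X ^ 2}.Nonempty := by
    refine ⟨C ^ 2 + 1, by positivity, fun X _ => ⟨?_, ?_⟩⟩
    · nlinarith [sq_nonneg (C * frobNorm X), sq_nonneg ‖A X‖]
    · have := pow_le_pow_left₀ (norm_nonneg _) (hbound X) 2
      nlinarith [sq_nonneg (frobNorm X)]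
  obtain ⟨δ, hδ, hlt⟩ := exists_lt_of_csInf_lt hne h
  exact ⟨δ, hlt, hδ.1, hδ.2⟩

theorem diagonal_sum {ι K : Type*} [DecidableEq K] (S : Finset ι)
    (t : ι → K → ℝ) : diagonal (∑ l ∈ S, t l) = ∑ l ∈ S, diagonal (t l) :=
  map_sum (diagonalAddMonoidHom K ℝ) t S

/-- A kernel element that splits into a low-rank part and an orthogonal part whose tail blocks are
dominated by the low-rank part has vanishing low-rank part. -/
theorem eq_zero_of_rip {m n d T N : ℕ}
    (A : Matrix (Fin m) (Fin n) ℝ →ₗ[ℝ] EuclideanSpace ℝ (Fin d)) (hT : 0 < T) {δ : ℝ}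
    (hδ0 : 0 ≤ δ) (hδ : δ < 1 / 5)
    (hrip : ∀ X : Matrix (Fin m) (Fin n) ℝ, X.rank ≤ 5 * T →
      (1 - δ) * frobNorm X ^ 2 ≤ ‖A X‖ ^ 2 ∧ ‖A X‖ ^ 2 ≤ (1 + δ) * frobNorm X ^ 2)
    {R : Matrix (Fin m) (Fin n) ℝ} (hR : R.rank ≤ 2 * T) {u : Matrix (Fin m) (Fin N) ℝ}
    {s : Fin N → ℝ} {v : Matrix (Fin n) (Fin N) ℝ} (hu : uᵀ * u = 1) (hv : vᵀ * v = 1)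
    (horth : uᵀ * R * v = 0) (hker : A (R + u * diagonal s * vᵀ) = 0)
    (htail : ∑ l ∈ Finset.range N,
      √(∑ k : Fin N, (if (k : ℕ) / (3 * T) = l + 1 then s k else 0) ^ 2) ≤
        √(2 / 3) * frobNorm R) : R = 0 := by
  set t : ℕ → Fin N → ℝ := fun l k => if (k : ℕ) / (3 * T) = l then s k else 0 with ht
  set B : ℕ → Matrix (Fin m) (Fin n) ℝ := fun l => u * diagonal (t l) * vᵀ with hB
  have hsum : s = ∑ l ∈ Finset.range (N + 1), t l := by
    funext k
    have hk : (k : ℕ) / (3 * T) < N + 1 :=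
      (Nat.div_le_self _ _).trans_lt (k.2.trans (Nat.lt_succ_self N))
    simp [ht, Finset.sum_apply, hk]
  have hBsum : u * diagonal s * vᵀ = ∑ l ∈ Finset.range N, B (l + 1) + B 0 := by
    rw [← Finset.sum_range_succ' B]
    conv_lhs => rw [hsum, diagonal_sum, Matrix.mul_sum, Matrix.sum_mul]
  have hBrank : ∀ l, (B l).rank ≤ 3 * T := by
    intro l
    refine (rank_mul_diagonal_mul_le u (t l) vᵀ).trans ?_
    refine le_trans (Finset.card_le_card fun k hk => ?_) (card_filter_div_eq_le (N := N) l (by omega))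
    simp only [Finset.mem_filter, Finset.mem_univ, true_and, ht] at hk ⊢
    by_contra hc
    simp [hc] at hk
  have hBnorm : ∀ l, frobNorm (B l) =
      √(∑ k : Fin N, (if (k : ℕ) / (3 * T) = l then s k else 0) ^ 2) :=
    fun l => frobNorm_svd hu hv (t l)
  have hAB : ∀ l, ‖A (B l)‖ ≤ √(1 + δ) * frobNorm (B l) := by
    intro l
    rw [← Real.sqrt_sq (frobNorm_nonneg (B l)), ← Real.sqrt_mul (by linarith)]
    exact Real.le_sqrt_of_sq_le (hrip _ ((hBrank l).trans (by omega))).2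
  have hA0 : A (R + B 0) = -∑ l ∈ Finset.range N, A (B (l + 1)) := by
    rw [hBsum] at hker
    rw [eq_neg_iff_add_eq_zero, ← map_sum, ← map_add, ← hker]
    congr 1
    abel
  have hA1 : ‖A (R + B 0)‖ ≤ √(1 + δ) * (√(2 / 3) * frobNorm R) := by
    rw [hA0, norm_neg]
    refine (norm_sum_le _ _).trans ((Finset.sum_le_sum fun l _ => hAB (l + 1)).trans ?_)
    rw [← Finset.mul_sum]
    simp only [hBnorm]
    exact mul_le_mul_of_nonneg_left htail (Real.sqrt_nonneg _)
  have hA2 : ‖A (R + B 0)‖ ^ 2 ≤ (1 + δ) * (2 / 3 * frobNorm R ^ 2) := by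
    have := pow_le_pow_left₀ (norm_nonneg _) hA1 2
    rwa [mul_pow, mul_pow, Real.sq_sqrt (by linarith), Real.sq_sqrt (by norm_num)] at this
  have hcross : (Rᵀ * B 0).trace = 0 := by
    have h1 : Rᵀ * B 0 = (Rᵀ * u * diagonal (t 0)) * vᵀ := by simp only [hB, Matrix.mul_assoc]
    have h2 : vᵀ * (Rᵀ * u * diagonal (t 0)) = (uᵀ * R * v)ᵀ * diagonal (t 0) := by
      simp only [transpose_mul, transpose_transpose, Matrix.mul_assoc]
    rw [h1, trace_mul_comm, h2, horth]
    simp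
  have hpyth : frobNorm (R + B 0) ^ 2 = frobNorm R ^ 2 + frobNorm (B 0) ^ 2 := by
    have h1 : ((B 0)ᵀ * R).trace = 0 := by
      rw [← trace_transpose, transpose_mul, transpose_transpose, hcross]
    rw [sq_frobNorm, sq_frobNorm, sq_frobNorm, transpose_add, Matrix.add_mul, Matrix.mul_add,
      Matrix.mul_add]
    simp only [trace_add, hcross, h1]
    ring
  have hlow := (hrip (R + B 0) ((rank_add_le_rank_add_rank_s10 _ _).trans
    (by have := hBrank 0; omega))).1
  rw [hpyth] at hlow
  have h0 : frobNorm R ^ 2 ≤ 0 := by nlinarith [sq_nonneg (frobNorm R), sq_nonneg (frobNorm (B 0))]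
  exact eq_zero_of_frobNorm_eq_zero (pow_eq_zero_iff two_ne_zero |>.1 (le_antisymm h0 (sq_nonneg _)))

theorem sum_sq_col_le_one {ι K : Type*} [Fintype ι] [DecidableEq K]
    {u : Matrix ι K ℝ} (hu : uᵀ * u = 1) (l : K) : ∑ i, u i l ^ 2 ≤ 1 := by
  have h := congrFun (congrFun hu l) l
  rw [Matrix.mul_apply, one_apply_eq] at h
  simpa [sq] using h.le

theorem fromCols_mul_diagonal_mul {ι κ K L : Type*} [Fintype K] [Fintype L]
    [DecidableEq K] [DecidableEq L] (u : Matrix ι K ℝ) (p : Matrix ι L ℝ) (v : Matrix κ K ℝ)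
    (q : Matrix κ L ℝ) (s : K → ℝ) (t : L → ℝ) :
    fromCols u p * diagonal (Sum.elim s t) * (fromCols v q)ᵀ =
      u * diagonal s * vᵀ + p * diagonal t * qᵀ := by
  ext i j
  rw [Matrix.mul_apply, Fintype.sum_sum_type, Matrix.add_apply, Matrix.mul_apply, Matrix.mul_apply]
  simp only [mul_diagonal, transpose_apply, fromCols_apply_inl, fromCols_apply_inr, Sum.elim_inl,
    Sum.elim_inr]

theorem fromCols_transpose_mul_self {ι K L : Type*} [Fintype ι] [DecidableEq K] [DecidableEq L]
    {u : Matrix ι K ℝ} {p : Matrix ι L ℝ} (hu : uᵀ * u = 1) (hp : pᵀ * p = 1)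
    (hup : uᵀ * p = 0) : (fromCols u p)ᵀ * fromCols u p = 1 := by
  have hpu : pᵀ * u = 0 := by
    rw [← transpose_transpose (pᵀ * u), transpose_mul, transpose_transpose, hup, transpose_zero]
  rw [transpose_fromCols, fromRows_mul_fromCols, hu, hp, hup, hpu, fromBlocks_one]

/-- Subadditivity of the fraction function of the singular values, for a left-hand side that splits
into two parts with orthogonal singular vectors. -/
theorem sum_fraction_add_le {ι κ K₁ K₂ L₁ L₂ : Type*} [Fintype ι] [Fintype κ]
    [Fintype K₁] [Fintype K₂] [Fintype L₁] [Fintype L₂] [DecidableEq K₁] [DecidableEq K₂]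
    [DecidableEq L₁] [DecidableEq L₂] {a : ℝ} (ha : 0 ≤ a)
    {u₁ : Matrix ι K₁ ℝ} {v₁ : Matrix κ K₁ ℝ} {s₁ : K₁ → ℝ}
    {u₂ : Matrix ι K₂ ℝ} {v₂ : Matrix κ K₂ ℝ} {s₂ : K₂ → ℝ}
    {p₁ : Matrix ι L₁ ℝ} {q₁ : Matrix κ L₁ ℝ} {t₁ : L₁ → ℝ}
    {p₂ : Matrix ι L₂ ℝ} {q₂ : Matrix κ L₂ ℝ} {t₂ : L₂ → ℝ}
    (hu₁ : u₁ᵀ * u₁ = 1) (hv₁ : v₁ᵀ * v₁ = 1) (hu₂ : u₂ᵀ * u₂ = 1) (hv₂ : v₂ᵀ * v₂ = 1)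
    (hu : u₁ᵀ * u₂ = 0) (hv : v₁ᵀ * v₂ = 0)
    (hp₁ : p₁ᵀ * p₁ = 1) (hq₁ : q₁ᵀ * q₁ = 1) (hp₂ : p₂ᵀ * p₂ = 1) (hq₂ : q₂ᵀ * q₂ = 1)
    (hs₁ : ∀ k, 0 ≤ s₁ k) (hs₂ : ∀ k, 0 ≤ s₂ k) (ht₁ : ∀ k, 0 ≤ t₁ k) (ht₂ : ∀ k, 0 ≤ t₂ k)
    (h : u₁ * diagonal s₁ * v₁ᵀ + u₂ * diagonal s₂ * v₂ᵀ =
      p₁ * diagonal t₁ * q₁ᵀ + p₂ * diagonal t₂ * q₂ᵀ) :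
    ∑ k, a * s₁ k / (a * s₁ k + 1) + ∑ k, a * s₂ k / (a * s₂ k + 1) ≤
      ∑ k, a * t₁ k / (a * t₁ k + 1) + ∑ k, a * t₂ k / (a * t₂ k + 1) := by
  have key := sum_div_one_add_le_of_svd_eq (fromCols u₁ u₂) (fromCols v₁ v₂)
    (fun k => a * Sum.elim s₁ s₂ k) (fromCols_transpose_mul_self hu₁ hu₂ hu)
    (fromCols_transpose_mul_self hv₁ hv₂ hv)
    (by rintro (k | k); exacts [mul_nonneg ha (hs₁ k), mul_nonneg ha (hs₂ k)])
    (fromCols p₁ p₂) (fromCols q₁ q₂) (fun k => a * Sum.elim t₁ t₂ k)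
    (by rintro (k | k); exacts [sum_sq_col_le_one hp₁ k, sum_sq_col_le_one hp₂ k])
    (by rintro (k | k); exacts [sum_sq_col_le_one hq₁ k, sum_sq_col_le_one hq₂ k])
    (by rintro (k | k); exacts [mul_nonneg ha (ht₁ k), mul_nonneg ha (ht₂ k)])
    (by
      change _ * diagonal (a • Sum.elim s₁ s₂) * _ = _ * diagonal (a • Sum.elim t₁ t₂) * _
      rw [diagonal_smul, diagonal_smul, Matrix.mul_smul, Matrix.smul_mul, Matrix.mul_smul, Matrix.smul_mul,
      fromCols_mul_diagonal_mul, fromCols_mul_diagonal_mul, h])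
  simpa [Fintype.sum_sum_type, add_comm] using key

theorem mul_eq_zero_of_svd {ι κ K l : Type*} [Fintype ι] [Fintype κ] [Fintype K] [DecidableEq K]
    {X : Matrix ι κ ℝ} {u : Matrix ι K ℝ} {v : Matrix κ K ℝ} {s : K → ℝ} (hv : vᵀ * v = 1)
    (hs : ∀ k, 0 < s k) (hX : X = u * diagonal s * vᵀ) {w : Matrix l ι ℝ} (hw : w * X = 0) :
    w * u = 0 := by
  have h : w * u * diagonal s = 0 := by
    calc w * u * diagonal s = w * (u * diagonal s * vᵀ) * v := by
          simp only [Matrix.mul_assoc, hv, Matrix.mul_one]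
      _ = 0 := by rw [← hX, hw, Matrix.zero_mul]
  ext i k
  have := congrFun (congrFun h i) k
  rw [mul_diagonal] at this
  exact (mul_eq_zero.1 this).resolve_right (hs k).ne'

theorem statement10 (m n d : ℕ) (hmn : m ≤ n)
    (A : Matrix (Fin m) (Fin n) ℝ →ₗ[ℝ] EuclideanSpace ℝ (Fin d))
    (b : EuclideanSpace ℝ (Fin d))
    (X₀ : Matrix (Fin m) (Fin n) ℝ) (T : ℕ) (hT : X₀.rank = T) (hT1 : 1 ≤ T)
    (h5T : 5 * T ≤ m)
    (hX₀ : A X₀ = b)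
    (hX₀min : ∀ X : Matrix (Fin m) (Fin n) ℝ, A X = b → X₀.rank ≤ X.rank)
    (a : ℝ) (ha1 : 1 < a) (ha2 : a < Real.sqrt (3 / 2))
    (hδ : ripConst A (5 * T) < (3 - 2 * a ^ 2) / (3 + 2 * a ^ 2)) :
    ∀ Xstar : Matrix (Fin m) (Fin n) ℝ,
      A Xstar = b →
      (∀ X : Matrix (Fin m) (Fin n) ℝ, A X = b → Pa a Xstar ≤ Pa a X) →
      Xstar = X₀ := by
  intro Y hY hYmin
  subst hT
  have ha0 : 0 < a := by linarith
  have hlt : (3 - 2 * a ^ 2) / (3 + 2 * a ^ 2) < 1 / 5 := by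
    rw [div_lt_div_iff₀ (by positivity) (by norm_num)]
    nlinarith
  obtain ⟨δ, hδlt, hδ0, hrip⟩ := exists_rip_bound_lt A hδ
  obtain ⟨N₀, s₀, u₀, v₀, hN₀, -, hs₀, hu₀, hv₀, hX, hPX⟩ := exists_compact_svd X₀
  obtain ⟨_, s₁, u₁, v₁, -, -, hs₁, hu₁, hv₁, hYsvd, hPY⟩ := exists_compact_svd Y
  set R := Y - X₀ with hR
  set Rc := (1 - u₀ * u₀ᵀ) * R * (1 - v₀ * v₀ᵀ) with hRc
  set R₀ := u₀ * (u₀ᵀ * R) + ((1 - u₀ * u₀ᵀ) * R * v₀) * v₀ᵀ with hR₀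
  have hsplit : R₀ + Rc = R := by
    rw [hR₀, hRc]
    simp only [Matrix.mul_sub, Matrix.sub_mul, Matrix.mul_one, Matrix.one_mul, Matrix.mul_assoc]
    abel
  have hR₀rank : R₀.rank ≤ 2 * X₀.rank := by
    have h1 : (u₀ * (u₀ᵀ * R)).rank ≤ N₀ :=
      (rank_mul_le_left _ _).trans (rank_le_width _)
    have h2 : (((1 - u₀ * u₀ᵀ) * R * v₀) * v₀ᵀ).rank ≤ N₀ :=
      (rank_mul_le_left _ _).trans (rank_le_width _)
    have h3 : R₀.rank ≤ _ := rank_add_le_rank_add_rank_s10 _ _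
    omega
  obtain ⟨N₂, s₂, u₂, v₂, -, hanti, hs₂, hu₂, hv₂, hRcsvd, -⟩ := exists_compact_svd Rc
  obtain ⟨N₃, s₃, u₃, v₃, hN₃, -, hs₃, hu₃, hv₃, hR₀svd, -⟩ := exists_compact_svd R₀
  have hu : u₀ᵀ * u₂ = 0 := by
    refine mul_eq_zero_of_svd hv₂ hs₂ hRcsvd ?_
    have h : u₀ᵀ * (1 - u₀ * u₀ᵀ) = 0 := by
      rw [Matrix.mul_sub, ← Matrix.mul_assoc, hu₀, Matrix.mul_one, Matrix.one_mul, sub_self]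
    rw [hRc, ← Matrix.mul_assoc, ← Matrix.mul_assoc, h, Matrix.zero_mul, Matrix.zero_mul]
  have hv : v₀ᵀ * v₂ = 0 := by
    have hRcsvd' : Rcᵀ = v₂ * diagonal s₂ * u₂ᵀ := by
      rw [hRcsvd]
      simp only [transpose_mul, transpose_transpose, diagonal_transpose, Matrix.mul_assoc]
    refine mul_eq_zero_of_svd hu₂ hs₂ hRcsvd' ?_
    have h : (1 - v₀ * v₀ᵀ) * v₀ = 0 := by
      rw [Matrix.sub_mul, Matrix.mul_assoc, hv₀, Matrix.mul_one, Matrix.one_mul, sub_self]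
    rw [← transpose_mul, hRc, Matrix.mul_assoc, h, Matrix.mul_zero, transpose_zero]
  have hconcave := sum_fraction_add_le ha0.le hu₀ hv₀ hu₂ hv₂ hu hv hu₁ hv₁
    (p₂ := -u₃) (by rw [transpose_neg, Matrix.neg_mul, Matrix.mul_neg, neg_neg, hu₃]) hv₃ (fun k => (hs₀ k).le)
    (fun k => (hs₂ k).le) (fun k => (hs₁ k).le) (fun k => (hs₃ k).le)
    (by
      rw [Matrix.neg_mul, Matrix.neg_mul, ← hX, ← hRcsvd, ← hYsvd, ← hR₀svd, ← sub_eq_add_neg,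
        eq_sub_iff_add_eq, add_assoc, add_comm Rc, hsplit, hR]
      abel)
  have hmin := hYmin X₀ hX₀
  rw [Pa, Pa, hPX (fun t => a * t / (a * t + 1)) (by simp),
    hPY (fun t => a * t / (a * t + 1)) (by simp)] at hmin
  have hcone : ∑ k, a * s₂ k / (a * s₂ k + 1) ≤ ∑ k, a * s₃ k / (a * s₃ k + 1) := by linarith
  have htail := sum_block_norms_le ha0 hT1 hanti hs₂ (fun k => (hs₃ k).le)
    (by rw [Fintype.card_fin, hN₃]; exact hR₀rank) hcone
  rw [← frobNorm_svd hu₃ hv₃, ← hR₀svd] at htail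
  have hR₀zero : R₀ = 0 := by
    refine eq_zero_of_rip A hT1 hδ0 (hδlt.trans hlt) hrip hR₀rank hu₂ hv₂ ?_ ?_ htail
    · have hu' : u₂ᵀ * u₀ = 0 := by
        rw [← transpose_transpose (u₂ᵀ * u₀), transpose_mul, transpose_transpose, hu,
          transpose_zero]
      rw [hR₀, Matrix.mul_add, Matrix.add_mul, ← Matrix.mul_assoc u₂ᵀ, hu', Matrix.zero_mul,
        Matrix.zero_mul, zero_add, Matrix.mul_assoc u₂ᵀ, Matrix.mul_assoc _ v₀ᵀ, hv,
        Matrix.mul_zero, Matrix.mul_zero]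
    · rw [← hRcsvd, hsplit, hR, map_sub, hY, hX₀, sub_self]
  have hRczero : Rc = 0 := by
    have hrank : R₀.rank = 0 := by rw [hR₀zero, rank_zero]
    have : IsEmpty (Fin N₃) := by rw [hN₃, hrank]; infer_instance
    rw [Fintype.sum_empty (fun k : Fin N₃ => _)] at hcone
    have hempty : IsEmpty (Fin N₂) := by
      by_contra hne
      rw [not_isEmpty_iff] at hne
      refine hcone.not_gt (Finset.sum_pos (fun k _ => ?_) Finset.univ_nonempty)
      have := hs₂ k
      positivity
    rw [hRcsvd]
    ext i j
    simp [Matrix.mul_apply]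
  rw [hR₀zero, hRczero, add_zero] at hsplit
  exact sub_eq_zero.1 hsplit.symm
end
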